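/- For every real t with 0 < t < 1, every real χ > 0 and every integer m ≥ 0, the series Σ_{L∈ℤ} t^{−mL} p_{t,χ}(L) converges absolutely and Σ_{L∈ℤ} (χ^{−1} t^{−L})^m p_{t,χ}(L) = t^{−m(m+1)/2} (t;t)_m / m!. (In other words, the random variable χ^{−1} t^{−𝓛} with ℤ-valued 𝓛 of law p_{t,χ} has m-th moment t^{−m(m+1)/2}(t;t)_m/m! for every m ≥ 0.) -/

import Mathlib

open scoped BigOperators

/-- `(t;t)_n = ∏_{r=1}^{n} (1 - t^r)`. -/
noncomputable def tPochN (t : ℝ) (n : ℕ) : ℝ := ∏ r ∈ Finset.range n, (1 - t ^ (r + 1))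

/-- `(t;t)_∞ = ∏_{r=1}^{∞} (1 - t^r)`. -/
noncomputable def tPochInf (t : ℝ) : ℝ := ∏' r : ℕ, (1 - t ^ (r + 1))

/-- The `m`-th term of the series defining the weight of `𝓛^{(1)}_{t,χ}` at `x`. -/
noncomputable def lterm (t χ : ℝ) (x : ℤ) (m : ℕ) : ℝ :=
  Real.exp (-χ * t ^ (x - (m : ℤ))) * (-1) ^ m * t ^ (m * (m - 1) / 2) / tPochN t m

/-- `p_{t,χ}(x) = (1/(t;t)_∞) Σ_{m≥0} e^{-χ t^{x-m}} (-1)^m t^{m(m-1)/2}/(t;t)_m`. -/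
noncomputable def pWeight (t χ : ℝ) (x : ℤ) : ℝ :=
  (tPochInf t)⁻¹ * ∑' m : ℕ, lterm t χ x m

noncomputable def cc (t : ℝ) (k : ℕ) : ℝ := (-1) ^ k * t ^ (k * (k - 1) / 2) / tPochN t k

lemma poch_pos (t : ℝ) (ht0 : 0 < t) (ht1 : t < 1) (n : ℕ) : 0 < tPochN t n := by
  unfold tPochN
  refine Finset.prod_pos fun r _ => ?_
  have := pow_lt_one₀ ht0.le ht1 (Nat.succ_ne_zero r)
  simpa using this

lemma cc_succ (t : ℝ) (ht0 : 0 < t) (ht1 : t < 1) (k : ℕ) :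
    cc t (k+1) * (1 - t^(k+1)) = - (cc t k * t^k) := by
  have h1 := poch_pos t ht0 ht1 k
  have h2 := poch_pos t ht0 ht1 (k+1)
  have h4 : (1 - t^(k+1)) ≠ 0 := by
    have := pow_lt_one₀ ht0.le ht1 (Nat.succ_ne_zero k)
    exact (by simpa using this : 0 < 1 - t^(k+1)).ne'
  have h3 : tPochN t (k+1) = tPochN t k * (1 - t^(k+1)) := by
    unfold tPochN; rw [Finset.prod_range_succ]
  have h5 : (k+1) * (k+1-1) / 2 = k*(k-1)/2 + k := by
    have := Nat.triangle_succ k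
    simpa using this
  unfold cc
  rw [h5, h3, pow_add t, pow_succ]
  field_simp

lemma cc_ne (t : ℝ) (ht0 : 0 < t) (ht1 : t < 1) (k : ℕ) : cc t k ≠ 0 := by
  have h1 := poch_pos t ht0 ht1 k
  unfold cc
  positivity

lemma sumE (t : ℝ) (ht0 : 0 < t) (ht1 : t < 1) (z : ℝ) (hz : 0 < z) :
    Summable fun k : ℕ => ((k:ℝ)+1) * (cc t k * z^k) := by
  refine summable_of_ratio_test_tendsto_lt_one (l := 0) one_pos (Filter.Eventually.of_forall fun k => ?_) ?_
  · have := cc_ne t ht0 ht1 k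
    positivity
  · have e : (fun n : ℕ => ‖((((n+1:ℕ):ℝ))+1) * (cc t (n+1) * z^(n+1))‖ / ‖((n:ℝ)+1) * (cc t n * z^n)‖)
        = fun n : ℕ => (1 + 1/((n:ℝ)+1)) * (t^n / (1 - t^(n+1)) * z) := by
      funext n
      have h := cc_succ t ht0 ht1 n
      have h4 : 0 < (1 - t^(n+1)) := by
        have := pow_lt_one₀ ht0.le ht1 (Nat.succ_ne_zero n)
        simpa using this
      have h5 : cc t (n+1) = - (cc t n * t^n) / (1 - t^(n+1)) := by
        rw [← h]; field_simp
      have hc := abs_pos.2 (cc_ne t ht0 ht1 n)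
      rw [h5]
      simp only [Real.norm_eq_abs, abs_mul, abs_div, abs_neg, abs_pow, abs_of_pos hz, abs_of_pos ht0, abs_of_pos h4]
      rw [abs_of_pos (a := ((n+1:ℕ):ℝ)+1) (by positivity), abs_of_pos (a := (n:ℝ)+1) (by positivity)]
      push_cast
      field_simp
      ring
    rw [e]
    have h1 := tendsto_pow_atTop_nhds_zero_of_lt_one ht0.le ht1
    have h2 := (Filter.tendsto_add_atTop_iff_nat 1).2 h1
    have h3 := (tendsto_one_div_add_atTop_nhds_zero_nat (𝕜 := ℝ)).const_add 1
    have h4 := (h1.div (h2.const_sub 1) (by norm_num)).mul_const z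
    simpa using h3.mul h4

lemma sumF (t : ℝ) (ht0 : 0 < t) (ht1 : t < 1) (z : ℝ) (hz : 0 < z) :
    Summable fun k : ℕ => cc t k * z^k := by
  refine Summable.of_norm_bounded (sumE t ht0 ht1 z hz).norm fun k => ?_
  rw [norm_mul ((k:ℝ)+1)]
  refine le_mul_of_one_le_left (norm_nonneg _) ?_
  rw [Real.norm_eq_abs, abs_of_pos (by positivity)]
  simp

lemma sumE' (t : ℝ) (ht0 : 0 < t) (ht1 : t < 1) (z : ℝ) (hz : 0 < z) :
    Summable fun k : ℕ => (k:ℝ) * (cc t k * z^k) := by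
  refine ((sumE t ht0 ht1 z hz).sub (sumF t ht0 ht1 z hz)).congr fun k => ?_
  ring

noncomputable def FF (t z : ℝ) : ℝ := ∑' k : ℕ, cc t k * z^k
noncomputable def EE (t z : ℝ) : ℝ := ∑' k : ℕ, (k:ℝ) * (cc t k * z^k)

lemma FF_rec (t : ℝ) (ht0 : 0 < t) (ht1 : t < 1) (z : ℝ) (hz : 0 < z) :
    FF t z = (1 - z) * FF t (t*z) := by
  have hz' : 0 < t * z := by positivity
  have s1 := sumF t ht0 ht1 z hz
  have s2 := sumF t ht0 ht1 (t*z) hz'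
  have : FF t z - FF t (t*z) = - z * FF t (t*z) := by
    unfold FF
    rw [← s1.tsum_sub s2, (s1.sub s2).tsum_eq_zero_add, ← tsum_mul_left]
    simp only [pow_zero, sub_self, zero_add]
    congr 1; funext k
    have h := cc_succ t ht0 ht1 k
    simp only [mul_pow]
    linear_combination z^(k+1) * h
  linarith

lemma EE_rec (t : ℝ) (ht0 : 0 < t) (ht1 : t < 1) (z : ℝ) (hz : 0 < z) :
    EE t z = (1 - z) * EE t (t*z) - z * FF t (t * z) := by
  have hz' : 0 < t * z := by positivity
  have s1 := sumE' t ht0 ht1 z hz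
  have s2 := sumE' t ht0 ht1 (t*z) hz'
  have s3 := sumF t ht0 ht1 (t*z) hz'
  have : EE t z - EE t (t*z) = - z * (EE t (t*z) + FF t (t*z)) := by
    unfold EE FF
    rw [← s1.tsum_sub s2, (s1.sub s2).tsum_eq_zero_add, ← s2.tsum_add s3, ← tsum_mul_left]
    simp only [pow_zero, sub_self, zero_add]
    congr 1; funext k
    have h := cc_succ t ht0 ht1 k
    simp only [mul_pow]
    push_cast
    linear_combination z^(k+1) * (k+1) * h
  linarith

lemma FF_zero (t : ℝ) (ht0 : 0 < t) (ht1 : t < 1) (j : ℕ) : FF t (t⁻¹^j) = 0 := by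
  induction j with
  | zero => rw [FF_rec t ht0 ht1 _ (by positivity)]; simp
  | succ j ih =>
    rw [FF_rec t ht0 ht1 _ (by positivity)]
    have : t * t⁻¹^(j+1) = t⁻¹^j := by rw [pow_succ']; field_simp
    rw [this, ih, mul_zero]

lemma FF_t (t : ℝ) (ht0 : 0 < t) (ht1 : t < 1) : FF t t = tPochInf t := by
  have h1 := tendsto_pow_atTop_nhds_zero_of_lt_one ht0.le ht1
  have hs : Summable fun r : ℕ => -t^(r+1) :=
    ((summable_nat_add_iff 1).2 (summable_geometric_of_lt_one ht0.le ht1)).neg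
  have hm : Filter.Tendsto (tPochN t) Filter.atTop (nhds (tPochInf t)) := by
    have : Multipliable fun r : ℕ => 1 + -t^(r+1) := multipliable_one_add_of_summable hs.norm
    have h := this.hasProd.tendsto_prod_nat
    simp only [← sub_eq_add_neg] at h
    exact h
  have hF : Filter.Tendsto (fun n : ℕ => FF t (t^(n+1))) Filter.atTop (nhds 1) := by
    have s0 := sumF t ht0 ht1 1 one_pos
    have hb : Filter.Tendsto (fun n : ℕ => ∑' k, cc t k * (t^(n+1))^k) Filter.atTop
        (nhds (∑' k, cc t k * 0^k)) := by
      refine tendsto_tsum_of_dominated_convergence s0.norm (fun k => ?_) (Filter.Eventually.of_forall fun n k => ?_)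
      · exact (((Filter.tendsto_add_atTop_iff_nat 1).2 h1).pow k).const_mul _
      · rw [norm_mul, norm_mul]
        refine mul_le_mul_of_nonneg_left ?_ (norm_nonneg _)
        have : (t^(n+1))^k ≤ 1 := pow_le_one₀ (by positivity) (pow_le_one₀ ht0.le ht1.le)
        rw [Real.norm_eq_abs, abs_of_pos (by positivity)]
        simpa using this
    have h0 : ∑' k, cc t k * (0:ℝ)^k = 1 := by
      rw [tsum_eq_single 0]
      · simp [cc, tPochN]
      · intro k hk; simp [hk]
    rw [h0] at hb
    exact hb
  have hr : ∀ n, FF t t = tPochN t n * FF t (t^(n+1)) := by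
    intro n
    induction n with
    | zero => simp [tPochN]
    | succ n ih =>
      rw [ih, FF_rec t ht0 ht1 (t^(n+1)) (by positivity), tPochN, tPochN, Finset.prod_range_succ, ← pow_succ']
      ring
  have := hm.mul hF
  simp only [← hr, mul_one] at this
  exact tendsto_nhds_unique tendsto_const_nhds this

lemma inf_ne (t : ℝ) (ht0 : 0 < t) (ht1 : t < 1) : tPochInf t ≠ 0 := by
  have hs : Summable fun r : ℕ => -t^(r+1) :=
    ((summable_nat_add_iff 1).2 (summable_geometric_of_lt_one ht0.le ht1)).neg
  have := tprod_one_add_ne_zero_of_summable (f := fun r : ℕ => -t^(r+1)) (fun r => by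
    have := pow_lt_one₀ ht0.le ht1 (Nat.succ_ne_zero r)
    have : 0 < 1 - t^(r+1) := by simpa using this
    exact (by simpa [sub_eq_add_neg] using this.ne')) hs.norm
  simpa [tPochInf, sub_eq_add_neg] using this

lemma tri_int (m : ℕ) : ((m:ℤ) * (m+1) / 2) = ((m * (m+1) / 2 : ℕ) : ℤ) := by
  push_cast; rfl

lemma EE_val (t : ℝ) (ht0 : 0 < t) (ht1 : t < 1) (m : ℕ) :
    EE t (t⁻¹^m) = - (tPochInf t) * ((-1)^m * t ^ (-((m : ℤ) * (m + 1) / 2)) * tPochN t m) := by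
  rw [tri_int, zpow_neg, zpow_natCast]
  induction m with
  | zero =>
    rw [EE_rec t ht0 ht1 _ (by positivity)]; simp [FF_t t ht0 ht1, tPochN]
  | succ m ih =>
    rw [EE_rec t ht0 ht1 _ (by positivity)]
    have : t * t⁻¹^(m+1) = t⁻¹^m := by rw [pow_succ']; field_simp
    have h5 : (m+1) * (m+1+1) / 2 = m*(m+1)/2 + (m+1) := by
      have := Nat.triangle_succ (m+1)
      simp at this
      rw [mul_comm, mul_comm m]; convert this using 2
    rw [this, FF_zero t ht0 ht1, ih, h5, tPochN, tPochN, Finset.prod_range_succ, pow_add]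
    simp only [inv_pow]
    field_simp
    ring

lemma bound_pos (χ s : ℝ) (hχ : 0 < χ) (hs : 0 < s) (hs1 : s ≤ 1) (m : ℕ) :
    |(s^m)⁻¹ * (Real.exp (-(χ * s)) - ∑ j ∈ Finset.range (m+1), (-(χ*s))^j / (j.factorial : ℝ))|
      ≤ χ^(m+1) * Real.exp χ * s := by
  have h := Complex.norm_exp_sub_sum_le_norm_mul_exp ((-(χ*s) : ℝ) : ℂ) (m+1)
  have e : Complex.exp ((-(χ*s) : ℝ) : ℂ) - ∑ j ∈ Finset.range (m+1), ((-(χ*s) : ℝ) : ℂ)^j / (j.factorial : ℂ)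
     = ((Real.exp (-(χ * s)) - ∑ j ∈ Finset.range (m+1), (-(χ*s))^j / (j.factorial : ℝ) : ℝ) : ℂ) := by
    push_cast; rfl
  rw [e, Complex.norm_real, Complex.norm_real, Real.norm_eq_abs, Real.norm_eq_abs, abs_neg, abs_of_pos (by positivity : 0 < χ * s)] at h
  rw [abs_mul, abs_of_pos (by positivity : 0 < (s^m)⁻¹)]
  calc _ ≤ (s^m)⁻¹ * ((χ*s)^(m+1) * Real.exp (χ * s)) := by gcongr
    _ = χ^(m+1) * Real.exp (χ*s) * s := by rw [mul_pow, pow_succ s]; field_simp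
    _ ≤ _ := by
      gcongr
      nlinarith

lemma bound_neg (χ s : ℝ) (hχ : 0 < χ) (hs : 0 < s) (hs1 : s ≤ 1) (m : ℕ) :
    |s^m * (Real.exp (-(χ * s⁻¹)) - ∑ j ∈ Finset.range m, (-(χ*s⁻¹))^j / (j.factorial : ℝ))|
      ≤ (χ⁻¹ + ∑ j ∈ Finset.range m, χ^j / (j.factorial : ℝ)) * s := by
  rw [mul_sub, add_mul, Finset.mul_sum, Finset.sum_mul]
  refine (abs_sub _ _).trans (add_le_add ?_ ((Finset.abs_sum_le_sum_abs _ _).trans (Finset.sum_le_sum fun j hj => ?_)))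
  · rw [abs_of_pos (by positivity)]
    have h1 : s^m ≤ 1 := pow_le_one₀ hs.le hs1
    have h2 : Real.exp (-(χ * s⁻¹)) ≤ χ⁻¹ * s := by
      rw [Real.exp_neg]
      have : χ * s⁻¹ ≤ Real.exp (χ * s⁻¹) := by linarith [Real.add_one_le_exp (χ * s⁻¹)]
      calc _ ≤ (χ * s⁻¹)⁻¹ := inv_anti₀ (by positivity) this
        _ = _ := by rw [mul_inv, inv_inv]
    calc _ ≤ 1 * (χ⁻¹ * s) := by gcongr
      _ = _ := one_mul _
  · have hj' := Finset.mem_range.1 hj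
    rw [abs_mul, abs_div, abs_pow (-(χ * s⁻¹)), abs_neg, abs_of_pos (by positivity : 0 < χ * s⁻¹), abs_of_pos (by positivity : 0 < s^m),
      abs_of_pos (by positivity : (0:ℝ) < j.factorial)]
    obtain ⟨d, rfl⟩ : ∃ d, m = j + 1 + d := ⟨m - (j+1), by omega⟩
    have h1 : s^d ≤ 1 := pow_le_one₀ hs.le hs1
    calc _ = χ^j / j.factorial * s * s^d := by
          rw [pow_add, pow_add, mul_pow, inv_pow]; field_simp
      _ ≤ χ^j / j.factorial * s * 1 := by gcongr
      _ = _ := mul_one _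

noncomputable def aa (t χ : ℝ) (m : ℕ) (n : ℤ) : ℝ :=
  t ^ (-(m:ℤ) * n) * (Real.exp (-(χ * t^n)) - ∑ j ∈ Finset.range m, (-(χ * t^n))^j / (j.factorial : ℝ)
    - if 0 ≤ n then (-(χ * t^n))^m / (m.factorial : ℝ) else 0)

lemma aa_summable (t χ : ℝ) (ht0 : 0 < t) (ht1 : t < 1) (hχ : 0 < χ) (m : ℕ) : Summable (aa t χ m) := by
  have hg := summable_geometric_of_lt_one ht0.le ht1
  refine Summable.of_nat_of_neg_add_one ?_ ?_
  · refine Summable.of_norm_bounded (hg.mul_left (χ^(m+1) * Real.exp χ)) fun k => ?_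
    refine le_trans (le_of_eq ?_) (bound_pos χ (t^k) hχ (by positivity) (pow_le_one₀ ht0.le ht1.le) m)
    rw [Real.norm_eq_abs, aa, if_pos (by positivity), Finset.sum_range_succ, zpow_natCast, sub_sub]
    congr 2
    rw [neg_mul, zpow_neg, mul_comm, zpow_mul, zpow_natCast, zpow_natCast]
  · refine Summable.of_norm_bounded (((summable_nat_add_iff 1).2 hg).mul_left
      (χ⁻¹ + ∑ j ∈ Finset.range m, χ^j / (j.factorial : ℝ))) fun k => ?_
    refine le_trans (le_of_eq ?_) (bound_neg χ (t^(k+1)) hχ (by positivity) (pow_le_one₀ ht0.le ht1.le) m)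
    have e : t ^ (-((k:ℤ)+1)) = (t^(k+1))⁻¹ := by
      rw [zpow_neg]; norm_cast
    have e2 : t ^ (-(m:ℤ) * -((k:ℤ)+1)) = (t^(k+1))^m := by
      rw [neg_mul_neg, mul_comm, zpow_mul]; norm_cast
    rw [Real.norm_eq_abs, aa, if_neg (by omega), e, e2, sub_zero]

noncomputable def ind (k : ℕ) (L : ℤ) : ℝ := if 0 ≤ L ∧ L < k then 1 else 0

lemma ind_nonneg (k : ℕ) (L : ℤ) : 0 ≤ ind k L := by
  unfold ind; split_ifs <;> simp

lemma fib (x : ℝ) (k : ℕ) : HasSum (fun L : ℤ => x * ind k L) (k * x) := by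
  have : HasSum (fun L : ℤ => x * ind k L) (∑ L ∈ Finset.Ico (0:ℤ) k, x * ind k L) := by
    refine hasSum_sum_of_ne_finset_zero fun L hL => ?_
    rw [Finset.mem_Ico] at hL
    rw [ind, if_neg hL, mul_zero]
  convert this using 1
  rw [Finset.sum_congr rfl (g := fun _ => x)]
  · simp
  · intro L hL
    rw [Finset.mem_Ico] at hL
    rw [ind, if_pos hL, mul_one]

lemma dbl (d : ℕ → ℝ) (hsE : Summable fun k : ℕ => (k:ℝ) * d k) :
    HasSum (fun p : ℤ × ℕ => d p.2 * ind p.2 p.1) (∑' k : ℕ, (k:ℝ) * d k) := by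
  have h1 : Summable (fun p : ℕ × ℤ => d p.1 * ind p.1 p.2) := by
    rw [← summable_abs_iff]
    have ea : (fun p : ℕ × ℤ => |d p.1 * ind p.1 p.2|)
       = fun p : ℕ × ℤ => |d p.1| * ind p.1 p.2 := by
      funext p; rw [abs_mul, abs_of_nonneg (ind_nonneg _ _)]
    rw [ea, summable_prod_of_nonneg (fun p => mul_nonneg (abs_nonneg _) (ind_nonneg _ _))]
    refine ⟨fun k => (fib |d k| k).summable, ?_⟩
    refine hsE.abs.congr fun k => ?_
    rw [abs_mul, Nat.abs_cast]
    exact (fib |d k| k).tsum_eq.symm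
  have h2 : HasSum (fun k : ℕ => (k:ℝ) * d k) _ := h1.hasSum.prod_fiberwise fun k => fib (d k) k
  have h3 := h2.tsum_eq
  have h4 := h1.hasSum
  rw [← h3] at h4
  exact ((Equiv.prodComm ℤ ℕ).hasSum_iff (f := fun p : ℕ × ℤ => d p.1 * ind p.1 p.2)).2 h4

lemma key (t χ : ℝ) (ht0 : 0 < t) (ht1 : t < 1) (hχ : 0 < χ) (m : ℕ) :
    HasSum (fun L : ℤ => t ^ (-(m : ℤ) * L) * ∑' k : ℕ, lterm t χ L k)
      (- ((-χ)^m / (m.factorial : ℝ)) * EE t (t⁻¹^m)) := by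
  set d : ℕ → ℝ := fun k => cc t k * (t⁻¹^m)^k with hd
  have hzm : 0 < t⁻¹^m := by positivity
  have sd : Summable d := sumF t ht0 ht1 _ hzm
  have d0 : ∑' k, d k = 0 := FF_zero t ht0 ht1 m
  have hd0 : HasSum d 0 := d0 ▸ sd.hasSum
  have sa := aa_summable t χ ht0 ht1 hχ m
  -- first double sum
  have A : HasSum (fun p : ℤ × ℕ => d p.2 * aa t χ m (p.1 - p.2)) 0 := by
    have h1 : Summable (fun p : ℕ × ℤ => d p.1 * aa t χ m p.2) :=
      summable_mul_of_summable_norm sd.norm sa.norm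
    have h2 := hd0.mul sa.hasSum h1
    rw [zero_mul] at h2
    let e : ℤ × ℕ ≃ ℕ × ℤ :=
      ⟨fun p => (p.2, p.1 - p.2), fun q => (q.2 + q.1, q.1), fun p => by simp, fun q => by simp⟩
    exact (e.hasSum_iff (f := fun p : ℕ × ℤ => d p.1 * aa t χ m p.2)).2 h2
  have B : HasSum (fun p : ℤ × ℕ => d p.2 * ind p.2 p.1) (EE t (t⁻¹^m)) :=
    dbl d (sumE' t ht0 ht1 _ hzm)
  have C := A.add (B.mul_left (- ((-χ)^m / (m.factorial : ℝ))))
  rw [zero_add] at C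
  refine C.prod_fiberwise fun L => ?_
  -- remaining: fiber
  have s1 : Summable fun k : ℕ => d k * aa t χ m (L - k) := A.summable.prod_factor L
  have s2 : Summable fun k : ℕ => -((-χ)^m / (m.factorial : ℝ)) * (d k * ind k L) :=
    (B.mul_left (- ((-χ)^m / (m.factorial : ℝ)))).summable.prod_factor L
  have h3 : HasSum (fun k : ℕ => ∑ j ∈ Finset.range m, (-χ)^j / (j.factorial:ℝ) * t^(((j:ℤ) - m) * L) * (cc t k * (t⁻¹^j)^k)) 0 := by
    have : ∀ j ∈ Finset.range m, HasSum (fun k : ℕ => (-χ)^j / (j.factorial:ℝ) * t^(((j:ℤ) - m) * L) * (cc t k * (t⁻¹^j)^k)) 0 := by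
      intro j _
      have h := (sumF t ht0 ht1 (t⁻¹^j) (by positivity)).hasSum
      have h0 : ∑' k, cc t k * (t⁻¹^j)^k = 0 := FF_zero t ht0 ht1 j
      rw [h0] at h
      simpa using h.mul_left ((-χ)^j / (j.factorial:ℝ) * t^(((j:ℤ) - m) * L))
    simpa using hasSum_sum this
  have h4 : HasSum (fun k : ℕ => ((-χ)^m / (m.factorial : ℝ) * (if 0 ≤ L then 1 else 0)) * d k) 0 := by
    simpa using hd0.mul_left ((-χ)^m / (m.factorial : ℝ) * (if 0 ≤ L then 1 else 0))
  have tot := ((s1.add s2).hasSum.add h3).add h4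
  have hpt : ∀ k : ℕ, t ^ (-(m : ℤ) * L) * lterm t χ L k = 
      d k * aa t χ m (L - k) + -((-χ)^m / (m.factorial : ℝ)) * (d k * ind k L)
       + ∑ j ∈ Finset.range m, (-χ)^j / (j.factorial:ℝ) * t^(((j:ℤ) - m) * L) * (cc t k * (t⁻¹^j)^k)
       + ((-χ)^m / (m.factorial : ℝ) * (if 0 ≤ L then 1 else 0)) * d k := by
    intro k
    have hz : ∀ j : ℕ, (t⁻¹^j)^k = t ^ (-((j:ℤ) * k)) := by
      intro j
      rw [zpow_neg, zpow_mul, inv_pow, inv_pow]; norm_cast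
    have e1 : d k * t ^ (-(m:ℤ) * (L - k)) = cc t k * t ^ (-(m:ℤ) * L) := by
      rw [hd]; dsimp only
      rw [hz, mul_assoc, ← zpow_add₀ ht0.ne']
      congr 2; ring
    have e2 : ∀ j : ℕ, t ^ (-(m:ℤ) * L) * (-(χ * t^(L-k)))^j = (-χ)^j * t^(((j:ℤ) - m) * L) * (t⁻¹^j)^k := by
      intro j
      rw [hz, ← neg_mul, mul_pow, mul_left_comm, mul_assoc, ← zpow_natCast (t^(L-(k:ℤ))), ← zpow_mul, ← zpow_add₀ ht0.ne', ← zpow_add₀ ht0.ne']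
      congr 2; ring
    have e3 : cc t k * (t ^ (-(m:ℤ) * L) * (-(χ * t^(L-k)))^m) = (-χ)^m * d k := by
      rw [e2, hd]; simp; ring
    have e4 : ∑ j ∈ Finset.range m, (-χ)^j / (j.factorial:ℝ) * t^(((j:ℤ) - m) * L) * (cc t k * (t⁻¹^j)^k)
        = cc t k * t ^ (-(m:ℤ) * L) * ∑ j ∈ Finset.range m, (-(χ * t^(L-k)))^j / (j.factorial : ℝ) := by
      rw [Finset.mul_sum]
      refine Finset.sum_congr rfl fun j _ => ?_
      have := e2 j
      linear_combination (- cc t k / (j.factorial : ℝ)) * this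
    have e5 : lterm t χ L k = cc t k * Real.exp (-(χ * t^(L-k))) := by
      unfold lterm cc; rw [neg_mul]; ring
    rw [e4, e5, aa, ind, ← mul_assoc (d k), e1]
    by_cases hL : 0 ≤ L
    · by_cases hk : L < k
      · rw [if_neg (by omega), if_pos ⟨hL, hk⟩, if_pos hL]; ring
      · rw [if_pos (by omega), if_neg (by omega), if_pos hL]
        linear_combination (1 / (m.factorial : ℝ)) * e3
    · rw [if_neg (by omega), if_neg (by omega), if_neg hL]; ring
  rw [add_zero, add_zero] at tot
  rw [← tsum_mul_left, funext hpt, tot.tsum_eq]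
  exact (s1.add s2).hasSum

theorem stmt2 (t χ : ℝ) (ht0 : 0 < t) (ht1 : t < 1) (hχ : 0 < χ) (m : ℕ) :
    (Summable fun L : ℤ => |t ^ (-(m : ℤ) * L) * pWeight t χ L|) ∧
    ∑' L : ℤ, (χ⁻¹ * t ^ (-L)) ^ m * pWeight t χ L =
      t ^ (-((m : ℤ) * (m + 1) / 2)) * tPochN t m / (Nat.factorial m : ℝ) := by
  have h := (key t χ ht0 ht1 hχ m).mul_left (tPochInf t)⁻¹
  have hi := inf_ne t ht0 ht1
  constructor
  · rw [summable_abs_iff]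
    refine h.summable.congr fun L => ?_
    unfold pWeight; ring
  · have h2 := h.mul_left (χ⁻¹^m)
    have e : (fun L : ℤ => (χ⁻¹ * t ^ (-L)) ^ m * pWeight t χ L) = fun L : ℤ => χ⁻¹^m * ((tPochInf t)⁻¹ * (t ^ (-(m : ℤ) * L) * ∑' k : ℕ, lterm t χ L k)) := by
      funext L
      have : t ^ (-(m : ℤ) * L) = (t^(-L))^m := by
        rw [← zpow_natCast (t^(-L)), ← zpow_mul]; congr 1; ring
      rw [this, mul_pow]; unfold pWeight; ring
    rw [e, h2.tsum_eq, EE_val t ht0 ht1, neg_pow χ]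
    have hm : ((-1:ℝ)^m) * (-1)^m = 1 := by rw [← mul_pow]; simp
    rw [inv_pow]
    generalize t ^ (-((m : ℤ) * (m + 1) / 2)) = y
    field_simp
    linear_combination (y * tPochN t m) * hm
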